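/- The Ẑ-module I_{n,𝔸_f}(E) of leading coefficients of degree-≤n polynomials in Int_{𝔸_f(ℚ)}(E, Ẑ) is a cyclic Ẑ-module if and only if the ℤ-module I_n(E) of leading coefficients of degree-≤n polynomials in Int_ℚ(E, Ẑ) is a cyclic ℤ-module (i.e., a principal fractional ideal of ℤ). -/

import Mathlib

open Polynomial

instance (p : Nat.Primes) : Fact (p : ℕ).Prime := ⟨p.2⟩

/-- `Ẑ = ∏_p ℤ_p`. -/
abbrev Zhat : Type := ∀ p : Nat.Primes, ℤ_[(p : ℕ)]

/-- Families of local polynomials; `𝔸_f(ℚ)[x]` is canonically identified with the set of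
such families having uniformly bounded degree and `p`-integral coefficients for all but
finitely many `p` (the coefficients then form finitely many finite adèles). -/
abbrev PolyProd : Type := ∀ p : Nat.Primes, Polynomial ℚ_[(p : ℕ)]

/-- `g : PolyProd` comes from a polynomial with coefficients in `𝔸_f(ℚ)`. -/
def IsAdelicPoly (g : PolyProd) : Prop :=
  (∃ N : ℕ, ∀ p, (g p).degree ≤ (N : ℕ)) ∧
    {p : Nat.Primes | ¬ ∀ k, ‖(g p).coeff k‖ ≤ 1}.Finite

/-- `Int_{𝔸_f(ℚ)}(E, Ẑ) = {g ∈ 𝔸_f(ℚ)[x] : g(E) ⊆ Ẑ}` (componentwise evaluation). -/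
def IntAf (E : Set Zhat) : Set PolyProd :=
  {g | IsAdelicPoly g ∧ ∀ α ∈ E, ∀ p : Nat.Primes, ‖(g p).eval ((α p : ℚ_[(p : ℕ)]))‖ ≤ 1}

/-- `Int_ℚ(E, Ẑ)`. -/
def IntQ (E : Set Zhat) : Set (Polynomial ℚ) :=
  {f | ∀ α ∈ E, ∀ p : Nat.Primes, ‖(Polynomial.aeval ((α p : ℚ_[(p : ℕ)]))) f‖ ≤ 1}

/-- The `n`-th characteristic `ℤ`-module of `Int_ℚ(E, Ẑ)`. -/
def In (E : Set Zhat) (n : ℕ) : Set ℚ :=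
  {c | ∃ f ∈ IntQ E, f.degree ≤ (n : ℕ) ∧ f.leadingCoeff = c}

/-- The `n`-th characteristic `Ẑ`-module of `Int_{𝔸_f(ℚ)}(E, Ẑ)`: the (degree-`n`)
leading coefficients of its elements of degree `≤ n`. -/
def InAf (E : Set Zhat) (n : ℕ) : Set (∀ p : Nat.Primes, ℚ_[(p : ℕ)]) :=
  {γ | ∃ g ∈ IntAf E, (∀ p, (g p).degree ≤ (n : ℕ)) ∧ γ = fun p => (g p).coeff n}

section Rat

variable {p : ℕ} [Fact p.Prime]

theorem norm_ratCast_le_one_iff (q : ℚ) : ‖(q : ℚ_[p])‖ ≤ 1 ↔ ¬ p ∣ q.den := by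
  refine ⟨fun h hd => ?_, fun h => Padic.norm_rat_le_one h⟩
  have h1 : ‖(q.den : ℚ_[p])‖ < 1 := Padic.norm_natCast_lt_one_iff.2 hd
  have h2 : ‖(q.num : ℚ_[p])‖ = 1 := by
    rw [Padic.norm_intCast_eq_one_iff, Int.isCoprime_iff_gcd_eq_one]
    have h3 : Nat.Coprime q.num.natAbs p := Nat.Coprime.coprime_dvd_right hd q.reduced
    simpa [Int.gcd] using h3
  have h4 : (q : ℚ_[p]) * (q.den : ℚ_[p]) = (q.num : ℚ_[p]) := by
    exact_mod_cast congrArg (Rat.cast : ℚ → ℚ_[p]) (Rat.mul_den_eq_num q)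
  have h5 := congrArg norm h4
  rw [norm_mul, h2] at h5
  nlinarith [norm_nonneg (q : ℚ_[p]), norm_nonneg (q.den : ℚ_[p])]

theorem norm_natCast_prime_zpow_of_ne {q : ℕ} [hq : Fact q.Prime] (h : p ≠ q) (k : ℤ) :
    ‖(q : ℚ_[p]) ^ k‖ = 1 := by
  have : ‖(q : ℚ_[p])‖ = 1 :=
    Padic.norm_natCast_eq_one_iff.2 ((Nat.coprime_primes Fact.out hq.out).2 h)
  rw [norm_zpow, this, one_zpow]

/-- A rational principal part of a `p`-adic number. -/
theorem exists_ratCast_norm_sub_le_one (x : ℚ_[p]) :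
    ∃ r : ℚ, ‖(r : ℚ_[p]) - x‖ ≤ 1 ∧
      ∀ (q : ℕ) [Fact q.Prime], q ≠ p → ‖(r : ℚ_[q])‖ ≤ 1 := by
  have hp : (1 : ℝ) < p := by exact_mod_cast (Fact.out : p.Prime).one_lt
  have hp0 : (p : ℚ_[p]) ≠ 0 := by exact_mod_cast (Fact.out : p.Prime).ne_zero
  obtain ⟨j, hj⟩ := pow_unbounded_of_one_lt ‖x‖ hp
  have hy : ‖x * (p : ℚ_[p]) ^ j‖ ≤ 1 := by
    rw [norm_mul, Padic.norm_p_pow, zpow_neg, zpow_natCast, ← div_eq_mul_inv]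
    exact div_le_one_of_le₀ hj.le (by positivity)
  set y : ℤ_[p] := ⟨x * (p : ℚ_[p]) ^ j, hy⟩ with hydef
  have hyc : (y : ℚ_[p]) = x * (p : ℚ_[p]) ^ j := rfl
  have h1 := (PadicInt.norm_le_pow_iff_mem_span_pow (y - (y.appr j : ℤ_[p])) j).2 (y.appr_spec j)
  rw [PadicInt.norm_def, PadicInt.coe_sub, PadicInt.coe_natCast, hyc] at h1
  refine ⟨(y.appr j : ℚ) * (p : ℚ) ^ (-(j : ℤ)), ?_, fun q _ hqp => ?_⟩
  · have h2 : (((y.appr j : ℚ) * (p : ℚ) ^ (-(j : ℤ)) : ℚ) : ℚ_[p]) - x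
        = -((x * (p : ℚ_[p]) ^ j - (y.appr j : ℚ_[p])) * (p : ℚ_[p]) ^ (-(j : ℤ))) := by
      push_cast
      rw [zpow_neg, zpow_natCast]
      field_simp
      ring
    rw [h2, norm_neg, norm_mul, Padic.norm_p_zpow, neg_neg]
    calc _ ≤ (p : ℝ) ^ (-(j : ℤ)) * (p : ℝ) ^ (j : ℤ) := by gcongr
      _ = 1 := by rw [← zpow_add₀ (by positivity)]; simp
  · push_cast
    rw [norm_mul, norm_natCast_prime_zpow_of_ne hqp, mul_one]
    exact_mod_cast Padic.norm_int_le_one (p := q) (y.appr j)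

theorem norm_eval_le_one {f : ℚ_[p][X]} (hf : ∀ k, ‖f.coeff k‖ ≤ 1) (x : ℤ_[p]) :
    ‖f.eval (x : ℚ_[p])‖ ≤ 1 := by
  rw [eval_eq_sum_range]
  refine IsUltrametricDist.norm_sum_le_of_forall_le_of_nonneg zero_le_one fun i _ => ?_
  rw [norm_mul, norm_pow]
  exact mul_le_one₀ (hf i) (by positivity) (pow_le_one₀ (norm_nonneg _) x.2)

theorem norm_add_le_one {x y : ℚ_[p]} (hx : ‖x‖ ≤ 1) (hy : ‖y‖ ≤ 1) : ‖x + y‖ ≤ 1 :=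
  (Padic.nonarchimedean x y).trans (max_le hx hy)

end Rat

theorem finite_not_norm_ratCast_le_one (c : ℚ) :
    {p : Nat.Primes | ¬ ‖(c : ℚ_[(p : ℕ)])‖ ≤ 1}.Finite := by
  refine Set.Finite.of_finite_image (f := fun p : Nat.Primes => (p : ℕ)) ?_
    Nat.Primes.coe_nat_injective.injOn
  refine c.den.divisors.finite_toSet.subset ?_
  rintro _ ⟨p, hp, rfl⟩
  rw [Set.mem_ofPred_eq, norm_ratCast_le_one_iff, not_not] at hp
  simpa using hp

theorem exists_intCast_eq_of_norm_le_one {q : ℚ}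
    (h : ∀ p : Nat.Primes, ‖(q : ℚ_[(p : ℕ)])‖ ≤ 1) : ∃ m : ℤ, (m : ℚ) = q := by
  refine ⟨q.num, (Rat.den_eq_one_iff q).1 ?_⟩
  by_contra hd
  obtain ⟨p, hp, hpd⟩ := Nat.exists_prime_and_dvd hd
  have : Fact p.Prime := ⟨hp⟩
  exact (norm_ratCast_le_one_iff (p := p) q).1 (h ⟨p, hp⟩) hpd

/-- A rational number with prescribed `p`-adic absolute values, almost all equal to `1`. -/
theorem exists_ratCast_norm_eq (γ : ∀ p : Nat.Primes, ℚ_[(p : ℕ)]) (h0 : ∀ p, γ p ≠ 0)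
    (hγ : {p : Nat.Primes | ‖γ p‖ ≠ 1}.Finite) :
    ∃ a : ℚ, ∀ p : Nat.Primes, ‖(a : ℚ_[(p : ℕ)])‖ = ‖γ p‖ := by
  classical
  refine ⟨∏ q ∈ hγ.toFinset, ((q : ℕ) : ℚ) ^ (γ q).valuation, fun p => ?_⟩
  push_cast
  rw [norm_prod]
  have h1 : ∀ q ∈ hγ.toFinset, q ≠ p →
      ‖((q : ℕ) : ℚ_[(p : ℕ)]) ^ (γ q).valuation‖ = 1 := fun q _ hqp =>
    norm_natCast_prime_zpow_of_ne (fun h => hqp (Subtype.ext h.symm)) _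
  by_cases hp : p ∈ hγ.toFinset
  · rw [Finset.prod_eq_single_of_mem p hp h1, Padic.norm_p_zpow,
      Padic.norm_eq_zpow_neg_valuation (h0 p)]
  · rw [Finset.prod_eq_one fun q hq => h1 q hq (fun h => hp (h ▸ hq))]
    simpa using (show ¬ ‖γ p‖ ≠ 1 by simpa using hp) |> fun h => (not_not.1 h).symm

/-- The coefficients of `X ^ n` in the polynomials of degree at most `n` over `ℚ_p` that are
`p`-integral on the `p`-th coordinates of `E`. -/
def localLead (E : Set Zhat) (n : ℕ) (p : Nat.Primes) : Set ℚ_[(p : ℕ)] :=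
  {c | ∃ f : ℚ_[(p : ℕ)][X], f.degree ≤ (n : ℕ) ∧
    (∀ α ∈ E, ‖f.eval (α p : ℚ_[(p : ℕ)])‖ ≤ 1) ∧ f.coeff n = c}

section localLead

variable {E : Set Zhat} {n : ℕ}

theorem norm_coeff_C_mul_X_pow_le_one {p : Nat.Primes} {c : ℚ_[(p : ℕ)]} (hc : ‖c‖ ≤ 1) (k : ℕ) :
    ‖(C c * X ^ n : ℚ_[(p : ℕ)][X]).coeff k‖ ≤ 1 := by
  rw [coeff_C_mul_X_pow]
  split_ifs
  · exact hc
  · simp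

theorem mem_localLead_of_norm_le_one {p : Nat.Primes} {c : ℚ_[(p : ℕ)]} (hc : ‖c‖ ≤ 1) :
    c ∈ localLead E n p :=
  ⟨C c * X ^ n, degree_C_mul_X_pow_le _ _,
    fun α _ => norm_eval_le_one (norm_coeff_C_mul_X_pow_le_one hc) (α p), by simp⟩

theorem mem_localLead_of_norm_le {p : Nat.Primes} {c d : ℚ_[(p : ℕ)]}
    (hc : c ∈ localLead E n p) (h : ‖d‖ ≤ ‖c‖) : d ∈ localLead E n p := by
  rcases eq_or_ne c 0 with rfl | hc0
  · rw [norm_zero] at h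
    exact mem_localLead_of_norm_le_one (h.trans zero_le_one)
  obtain ⟨f, hf, hE, rfl⟩ := hc
  have hu : ‖d / f.coeff n‖ ≤ 1 := by
    rw [norm_div]
    exact div_le_one_of_le₀ h (norm_nonneg _)
  refine ⟨C (d / f.coeff n) * f, ?_, fun α hα => ?_, ?_⟩
  · rw [← smul_eq_C_mul]
    exact (degree_smul_le _ _).trans hf
  · rw [eval_mul, eval_C, norm_mul]
    exact mul_le_one₀ hu (norm_nonneg _) (hE α hα)
  · rw [coeff_C_mul, div_mul_cancel₀ _ hc0]

theorem mem_InAf_iff {γ : ∀ p : Nat.Primes, ℚ_[(p : ℕ)]} :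
    γ ∈ InAf E n ↔ (∀ p, γ p ∈ localLead E n p) ∧ {p : Nat.Primes | ¬ ‖γ p‖ ≤ 1}.Finite := by
  classical
  constructor
  · rintro ⟨g, ⟨⟨-, hfin⟩, hE⟩, hdeg, rfl⟩
    exact ⟨fun p => ⟨g p, hdeg p, fun α hα => hE α hα p, rfl⟩,
      hfin.subset fun p hp h => hp (h n)⟩
  · rintro ⟨hγ, hfin⟩
    choose f hdeg hE hc using hγ
    let g : PolyProd := fun p => if ‖γ p‖ ≤ 1 then C (γ p) * X ^ n else f p
    have hg1 : ∀ p, ‖γ p‖ ≤ 1 → g p = C (γ p) * X ^ n := fun p h => if_pos h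
    have hg2 : ∀ p, ¬ ‖γ p‖ ≤ 1 → g p = f p := fun p h => if_neg h
    have hgdeg : ∀ p, (g p).degree ≤ (n : ℕ) := fun p => by
      by_cases h : ‖γ p‖ ≤ 1
      · rw [hg1 p h]; exact degree_C_mul_X_pow_le _ _
      · rw [hg2 p h]; exact hdeg p
    refine ⟨g, ⟨⟨⟨n, hgdeg⟩, hfin.subset fun p hp h => hp ?_⟩, fun α hα p => ?_⟩, hgdeg, ?_⟩
    · rw [hg1 p h]
      exact norm_coeff_C_mul_X_pow_le_one h
    · by_cases h : ‖γ p‖ ≤ 1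
      · rw [hg1 p h]; exact norm_eval_le_one (norm_coeff_C_mul_X_pow_le_one h) (α p)
      · rw [hg2 p h]; exact hE p α hα
    · funext p
      by_cases h : ‖γ p‖ ≤ 1
      · rw [hg1 p h]; simp
      · rw [hg2 p h, hc]

theorem mem_localLead_of_mem_In {c : ℚ} (hc : c ∈ In E n) (p : Nat.Primes) :
    (c : ℚ_[(p : ℕ)]) ∈ localLead E n p := by
  obtain ⟨f, hf, hdeg, rfl⟩ := hc
  have hn : f.natDegree ≤ n := natDegree_le_of_degree_le hdeg
  refine ⟨X ^ (n - f.natDegree) * f.map (algebraMap ℚ ℚ_[(p : ℕ)]), ?_, fun α hα => ?_, ?_⟩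
  · refine degree_le_of_natDegree_le (natDegree_mul_le.trans ?_)
    rw [natDegree_X_pow, natDegree_map]
    omega
  · rw [eval_mul, eval_pow, eval_X, eval_map_algebraMap, norm_mul, norm_pow]
    exact mul_le_one₀ (pow_le_one₀ (norm_nonneg _) (α p).2) (norm_nonneg _) (hf α hα p)
  · rw [coeff_X_pow_mul', if_pos (Nat.sub_le _ _), Nat.sub_sub_self hn, coeff_map,
      coeff_natDegree, eq_ratCast]

/-- Simultaneous approximation at finitely many primes, integral at all the others. -/
theorem exists_ratCast_approx (T : Finset Nat.Primes) (x : ∀ p : Nat.Primes, ℚ_[(p : ℕ)]) :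
    ∃ b : ℚ, (∀ p ∈ T, ‖(b : ℚ_[(p : ℕ)]) - x p‖ ≤ 1) ∧
      ∀ p ∉ T, ‖(b : ℚ_[(p : ℕ)])‖ ≤ 1 := by
  classical
  choose r hr hr' using fun p : Nat.Primes => exists_ratCast_norm_sub_le_one (x p)
  have hne : ∀ p q : Nat.Primes, q ≠ p → ‖(r q : ℚ_[(p : ℕ)])‖ ≤ 1 := fun p q h =>
    hr' q p fun h' => h (Subtype.ext h'.symm)
  refine ⟨∑ q ∈ T, r q, fun p hp => ?_, fun p hp => ?_⟩
  · push_cast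
    rw [← Finset.add_sum_erase T _ hp, add_sub_right_comm]
    exact norm_add_le_one (hr p)
      (IsUltrametricDist.norm_sum_le_of_forall_le_of_nonneg zero_le_one fun q hq =>
        hne p q (Finset.ne_of_mem_erase hq))
  · push_cast
    exact IsUltrametricDist.norm_sum_le_of_forall_le_of_nonneg zero_le_one fun q hq =>
      hne p q fun h => hp (h ▸ hq)

theorem mem_In_of_mem_localLead {c : ℚ} (hc : ∀ p : Nat.Primes, (c : ℚ_[(p : ℕ)]) ∈ localLead E n p) :
    c ∈ In E n := by
  classical
  rcases eq_or_ne c 0 with rfl | hc0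
  · exact ⟨0, fun α _ p => by simp, by simp, by simp⟩
  set T := (finite_not_norm_ratCast_le_one c).toFinset with hT
  choose g hdeg hE hlead using hc
  choose b hb hb' using fun k : ℕ => exists_ratCast_approx T fun p => (g p).coeff k
  set f : ℚ[X] := C c * X ^ n + ∑ k ∈ Finset.range n, C (b k) * X ^ k with hf
  have hcoeff : ∀ k, f.coeff k = if k = n then c else if k < n then b k else 0 := fun k => by
    rw [hf, coeff_add, coeff_C_mul_X_pow, finsetSum_coeff]
    simp only [coeff_C_mul_X_pow]
    rw [Finset.sum_ite_eq]
    simp only [Finset.mem_range]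
    split_ifs <;> first | omega | simp
  have hfdeg : f.natDegree ≤ n := natDegree_le_iff_coeff_eq_zero.2 fun k hk => by
    rw [hcoeff, if_neg (by omega), if_neg (by omega)]
  refine ⟨f, fun α hα p => ?_, degree_le_of_natDegree_le hfdeg, ?_⟩
  · rw [← eval_map_algebraMap]
    by_cases hp : p ∈ T
    · rw [← sub_add_cancel (f.map (algebraMap ℚ ℚ_[(p : ℕ)])) (g p), eval_add]
      refine norm_add_le_one (norm_eval_le_one (fun k => ?_) (α p)) (hE p α hα)
      rw [coeff_sub, coeff_map, hcoeff, eq_ratCast]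
      split_ifs with h1 h2
      · rw [h1, hlead]; simp
      · exact hb k p hp
      · rw [coeff_eq_zero_of_degree_lt ((hdeg p).trans_lt (by exact_mod_cast (by omega : n < k)))]
        simp
    · refine norm_eval_le_one (fun k => ?_) (α p)
      rw [coeff_map, hcoeff, eq_ratCast]
      split_ifs
      · simpa [hT] using hp
      · exact hb' k p hp
      · simp
  · have hn : f.coeff n = c := by rw [hcoeff, if_pos rfl]
    rw [leadingCoeff, le_antisymm hfdeg (le_natDegree_of_ne_zero (hn ▸ hc0)), hn]

theorem mem_In_iff {c : ℚ} :
    c ∈ In E n ↔ ∀ p : Nat.Primes, (c : ℚ_[(p : ℕ)]) ∈ localLead E n p :=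
  ⟨mem_localLead_of_mem_In, mem_In_of_mem_localLead⟩

theorem InAf_cyclic_iff_exists_localLead :
    (∃ γ₀ : ∀ p : Nat.Primes, ℚ_[(p : ℕ)],
        InAf E n = Set.range fun c : Zhat => fun p : Nat.Primes => (c p : ℚ_[(p : ℕ)]) * γ₀ p)
      ↔ ∃ a : ℚ, a ≠ 0 ∧ ∀ (p : Nat.Primes) (d : ℚ_[(p : ℕ)]),
          d ∈ localLead E n p ↔ ‖d‖ ≤ ‖(a : ℚ_[(p : ℕ)])‖ := by
  classical
  constructor
  · rintro ⟨γ, hγ⟩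
    have hmem : γ ∈ InAf E n := by
      rw [hγ]
      exact ⟨1, by simp⟩
    rw [mem_InAf_iff] at hmem
    have hle : ∀ (p : Nat.Primes) (d : ℚ_[(p : ℕ)]), d ∈ localLead E n p → ‖d‖ ≤ ‖γ p‖ := by
      intro p d hd
      have hu : Function.update (0 : ∀ p : Nat.Primes, ℚ_[(p : ℕ)]) p d ∈ InAf E n := by
        refine mem_InAf_iff.2 ⟨fun q => ?_, (Set.finite_singleton p).subset fun q hq => ?_⟩
        · rcases eq_or_ne q p with rfl | hqp
          · simpa using hd
          · rw [Function.update_of_ne hqp]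
            exact mem_localLead_of_norm_le_one (by simp)
        · by_contra hqp
          exact hq (by rw [Function.update_of_ne hqp]; simp)
      rw [hγ] at hu
      obtain ⟨c, hc⟩ := hu
      have hcp := congrFun hc p
      rw [Function.update_self] at hcp
      rw [← hcp, norm_mul]
      exact mul_le_of_le_one_left (norm_nonneg _) (c p).2
    have hone : ∀ p, 1 ≤ ‖γ p‖ := fun p => by
      simpa using hle p 1 (mem_localLead_of_norm_le_one (by simp))
    obtain ⟨a, ha⟩ := exists_ratCast_norm_eq γ
      (fun p h => by have := hone p; rw [h, norm_zero] at this; linarith)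
      (hmem.2.subset fun p hp h => hp (le_antisymm h (hone p)))
    refine ⟨a, ?_, fun p d => ?_⟩
    · rintro rfl
      have h1 := ha ⟨2, Nat.prime_two⟩
      have h2 := hone ⟨2, Nat.prime_two⟩
      rw [← h1] at h2
      simp at h2
      linarith
    · rw [ha]
      exact ⟨hle p d, mem_localLead_of_norm_le (hmem.1 p)⟩
  · rintro ⟨a, ha0, ha⟩
    refine ⟨fun p => (a : ℚ_[(p : ℕ)]), Set.ext fun γ => ?_⟩
    rw [mem_InAf_iff]
    constructor
    · rintro ⟨hγ, -⟩
      have hu : ∀ p, ‖γ p / (a : ℚ_[(p : ℕ)])‖ ≤ 1 := fun p => by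
        rw [norm_div]
        exact div_le_one_of_le₀ ((ha p _).1 (hγ p)) (norm_nonneg _)
      refine ⟨fun p => ⟨_, hu p⟩, funext fun p => ?_⟩
      exact div_mul_cancel₀ _ (by exact_mod_cast ha0)
    · rintro ⟨c, rfl⟩
      have hle : ∀ p : Nat.Primes, ‖(c p : ℚ_[(p : ℕ)]) * (a : ℚ_[(p : ℕ)])‖ ≤ ‖(a : ℚ_[(p : ℕ)])‖ :=
        fun p => by
          rw [norm_mul]
          exact mul_le_of_le_one_left (norm_nonneg _) (c p).2
      exact ⟨fun p => (ha p _).2 (hle p),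
        (finite_not_norm_ratCast_le_one a).subset fun p hp h => hp ((hle p).trans h)⟩

theorem In_cyclic_iff_exists_localLead :
    (∃ a : ℚ, In E n = Set.range fun m : ℤ => (m : ℚ) * a)
      ↔ ∃ a : ℚ, a ≠ 0 ∧ ∀ (p : Nat.Primes) (d : ℚ_[(p : ℕ)]),
          d ∈ localLead E n p ↔ ‖d‖ ≤ ‖(a : ℚ_[(p : ℕ)])‖ := by
  constructor
  · rintro ⟨a, ha⟩
    have ha0 : a ≠ 0 := by
      have h1 : (1 : ℚ) ∈ In E n :=
        mem_In_iff.2 fun p => mem_localLead_of_norm_le_one (by simp)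
      rw [ha] at h1
      obtain ⟨m, hm⟩ := h1
      rintro rfl
      simp at hm
    have hmem : ∀ p : Nat.Primes, (a : ℚ_[(p : ℕ)]) ∈ localLead E n p :=
      mem_In_iff.1 (ha ▸ ⟨1, by simp⟩)
    refine ⟨a, ha0, fun p d => ⟨fun hd => ?_, mem_localLead_of_norm_le (hmem p)⟩⟩
    by_contra! hlt
    have hp1 : (1 : ℝ) < (p : ℕ) := by exact_mod_cast p.2.one_lt
    have hap : (a : ℚ_[(p : ℕ)]) ≠ 0 := by exact_mod_cast ha0
    have hd0 : d ≠ 0 := by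
      rintro rfl
      rw [norm_zero] at hlt
      linarith [norm_nonneg (a : ℚ_[(p : ℕ)])]
    have hdiv : a / ((p : ℕ) : ℚ) ∈ In E n := by
      refine mem_In_iff.2 fun q => ?_
      rcases eq_or_ne q p with rfl | hqp
      · refine mem_localLead_of_norm_le hd ?_
        push_cast
        rw [norm_div, Padic.norm_p, div_inv_eq_mul]
        rw [Padic.norm_eq_zpow_neg_valuation hap, Padic.norm_eq_zpow_neg_valuation hd0] at *
        rw [zpow_lt_zpow_iff_right₀ hp1] at hlt
        rw [← zpow_add_one₀ (by positivity)]
        exact zpow_le_zpow_right₀ hp1.le (by omega)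
      · refine mem_localLead_of_norm_le (hmem q) ?_
        push_cast
        have := norm_natCast_prime_zpow_of_ne (p := (q : ℕ)) (q := (p : ℕ))
          (fun h => hqp (Subtype.ext h)) 1
        rw [zpow_one] at this
        rw [norm_div, this, div_one]
    rw [ha] at hdiv
    obtain ⟨m, hm⟩ := hdiv
    have hpq : ((p : ℕ) : ℚ) ≠ 0 := by exact_mod_cast p.2.ne_zero
    have hmp : (m : ℚ) * (p : ℕ) = 1 := by
      simp only at hm
      field_simp at hm
      linarith
    have hmp' : m * ((p : ℕ) : ℤ) = 1 := by exact_mod_cast hmp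
    have := Int.isUnit_iff.1 (IsUnit.of_mul_eq_one_right _ hmp')
    have := p.2.two_le
    omega
  · rintro ⟨a, ha0, ha⟩
    refine ⟨a, Set.ext fun c => ?_⟩
    rw [mem_In_iff]
    constructor
    · intro hc
      obtain ⟨m, hm⟩ := exists_intCast_eq_of_norm_le_one (q := c / a) fun p => by
        push_cast
        rw [norm_div]
        exact div_le_one_of_le₀ ((ha p _).1 (hc p)) (norm_nonneg _)
      exact ⟨m, by simp only [hm, div_mul_cancel₀ _ ha0]⟩
    · rintro ⟨m, rfl⟩ p
      rw [ha]
      push_cast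
      rw [norm_mul]
      exact mul_le_of_le_one_left (norm_nonneg _) (Padic.norm_int_le_one m)

end localLead

/-- `I_{n,𝔸_f}(E)` is a cyclic `Ẑ`-module iff `I_n(E)` is a cyclic
`ℤ`-module (a principal fractional ideal of `ℤ`). -/
theorem InAf_cyclic_iff_In_cyclic (Ep : ∀ p : Nat.Primes, Set ℤ_[(p : ℕ)]) (n : ℕ) :
    (∃ γ₀ : ∀ p : Nat.Primes, ℚ_[(p : ℕ)],
        InAf (Set.univ.pi Ep) n
          = Set.range fun c : Zhat => fun p : Nat.Primes => (c p : ℚ_[(p : ℕ)]) * γ₀ p)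
      ↔ ∃ a : ℚ, In (Set.univ.pi Ep) n = Set.range fun m : ℤ => (m : ℚ) * a := by
  exact InAf_cyclic_iff_exists_localLead.trans In_cyclic_iff_exists_localLead.symm
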